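/- arXiv:2207.09253 — 2 statements merged into one kernel-verified Lean document; each statement's English description precedes it below -/
import Mathlib

section
/- A pair (Qa, Qb) ∈ [0,1]² is reduced form implementable if and only if for every j ∈ {0,1,...,n} both of the following inequalities hold: j·(1−π)·Qb − (n−j)·π·Qa + ∑_{k=j}^n (k−j)·B(k) ≥ 0, and (n−j)·π·Qa − j·(1−π)·Qb + ∑_{k=0}^j (j−k)·B(k) ≥ 0. -/
open Finset

lemma rf_sum_low (n j : ℕ) (hj : j ≤ n) (g : ℕ → ℝ) :
    ∑ k ∈ range (j + 1), g k = ∑ k ∈ range (n + 1), if k ≤ j then g k else 0 := by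
  rw [← Finset.sum_filter]
  congr 1
  ext k
  simp only [mem_range, mem_filter]
  omega

lemma rf_sum_high (n j : ℕ) (g : ℕ → ℝ) :
    ∑ k ∈ Icc j n, g k = ∑ k ∈ range (n + 1), if j ≤ k then g k else 0 := by
  rw [← Finset.sum_filter]
  congr 1
  ext k
  simp only [mem_range, mem_filter, mem_Icc]
  omega

lemma rf_threshold (B : ℕ → ℝ) (s : ℝ) (hs0 : 0 ≤ s) (n : ℕ)
    (h : s ≤ ∑ k ∈ range (n + 1), B k) :
    ∃ m ≤ n, ∑ k ∈ range m, B k ≤ s ∧ s ≤ ∑ k ∈ range (m + 1), B k := by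
  induction n with
  | zero => exact ⟨0, le_rfl, by simpa using hs0, h⟩
  | succ n ih =>
    by_cases h' : s ≤ ∑ k ∈ range (n + 1), B k
    · obtain ⟨m, hm, h1⟩ := ih h'
      exact ⟨m, by omega, h1⟩
    · exact ⟨n + 1, le_rfl, (not_le.mp h').le, h⟩

lemma rf_lower (n : ℕ) (B : ℕ → ℝ) (hB : ∀ k ≤ n, 0 ≤ B k)
    (hBsum : ∑ k ∈ range (n + 1), B k = 1) (s : ℝ) (hs0 : 0 ≤ s) (hs1 : s ≤ 1) :
    ∃ q : ℕ → ℝ, (∀ k, 0 ≤ q k ∧ q k ≤ 1) ∧ ∃ m ≤ n,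
      ∑ k ∈ range (n + 1), q k * B k = s ∧
      ∑ k ∈ range (n + 1), (k : ℝ) * q k * B k
        = m * s - ∑ k ∈ range (m + 1), ((m : ℝ) - k) * B k := by
  obtain ⟨m, hm, h1, h2⟩ := rf_threshold B s hs0 n (by rw [hBsum]; exact hs1)
  rw [sum_range_succ] at h2
  have ht : ∃ t : ℝ, 0 ≤ t ∧ t ≤ 1 ∧ t * B m = s - ∑ k ∈ range m, B k := by
    rcases (hB m hm).eq_or_lt with h0 | h0
    · exact ⟨0, le_rfl, zero_le_one, by linarith⟩
    · refine ⟨(s - ∑ k ∈ range m, B k) / B m, div_nonneg (by linarith) h0.le, ?_, ?_⟩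
      · rw [div_le_one h0]; linarith
      · field_simp
  obtain ⟨t, ht0, ht1, ht⟩ := ht
  have key : ∀ g : ℕ → ℝ, ∑ k ∈ range (n + 1),
      g k * (if k < m then 1 else if k = m then t else 0) * B k
        = ∑ k ∈ range m, g k * B k + g m * (t * B m) := by
    intro g
    have e : ∑ k ∈ range m, g k * B k + g m * (t * B m)
        = ∑ k ∈ range (m + 1), g k * (if k < m then 1 else if k = m then t else 0) * B k := by
      rw [sum_range_succ]
      congr 1
      · apply sum_congr rfl
        intro k hk
        simp [mem_range.mp hk]
      · simp; ring
    rw [e, rf_sum_low n m hm]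
    apply sum_congr rfl
    intro k _
    split_ifs <;> first | rfl | omega | simp
  refine ⟨fun k => if k < m then 1 else if k = m then t else 0, ?_, m, hm, ?_, ?_⟩
  · intro k
    dsimp only
    split_ifs <;> constructor <;> linarith
  · have := key (fun _ => 1)
    simp only [one_mul] at this
    rw [this, ht]; ring
  · have := key (fun k => (k : ℝ))
    rw [this, ht, sum_range_succ]
    simp only [sub_mul, sum_sub_distrib, ← mul_sum]
    ring

lemma rf_high_eq (n : ℕ) (π : ℝ) (B : ℕ → ℝ)
    (hBsum : ∑ k ∈ range (n + 1), B k = 1)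
    (hBmean : ∑ k ∈ range (n + 1), (k : ℝ) * B k = n * π) (j : ℕ) (hj : j ≤ n) :
    ∑ k ∈ Icc j n, ((k : ℝ) - j) * B k
      = n * π - j + ∑ k ∈ range (j + 1), ((j : ℝ) - k) * B k := by
  have e : (n : ℝ) * π - j = ∑ k ∈ range (n + 1), ((k : ℝ) - j) * B k := by
    simp only [sub_mul, sum_sub_distrib, ← mul_sum, hBsum, hBmean]; ring
  rw [e, rf_sum_high, rf_sum_low n j hj, ← sum_add_distrib]
  apply sum_congr rfl
  intro k _
  split_ifs with h1 h2 h2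
  · obtain rfl : j = k := le_antisymm h1 h2
    ring
  · ring
  · ring
  · omega

lemma rf_bound (n : ℕ) (B : ℕ → ℝ) (hB : ∀ k ≤ n, 0 ≤ B k) (q : ℕ → ℝ)
    (hq : ∀ k ≤ n, 0 ≤ q k ∧ q k ≤ 1) (j : ℕ) (hj : j ≤ n) :
    0 ≤ ∑ k ∈ range (n + 1), ((k : ℝ) - j) * q k * B k
      + ∑ k ∈ range (j + 1), ((j : ℝ) - k) * B k := by
  rw [rf_sum_low n j hj, ← sum_add_distrib]
  apply sum_nonneg
  intro k hk
  have hk' : k ≤ n := by have := mem_range.mp hk; omega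
  obtain ⟨h0, h1⟩ := hq k hk'
  have hb := hB k hk'
  split_ifs with h
  · have h' : (k : ℝ) ≤ j := by exact_mod_cast h
    have : 0 ≤ ((j : ℝ) - k) * (1 - q k) * B k :=
      mul_nonneg (mul_nonneg (by linarith) (by linarith)) hb
    linarith
  · have h' : (j : ℝ) ≤ k := by exact_mod_cast (not_le.mp h).le
    have : 0 ≤ ((k : ℝ) - j) * q k * B k :=
      mul_nonneg (mul_nonneg (by linarith) h0) hb
    linarith

/-- Theorem 1 (main theorem): `(Qa, Qb) ∈ [0,1]²` is reduced form implementable iff the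
`2(n+1)` linear inequalities hold. -/
theorem reduced_form_implementable_iff
    (n : ℕ) (hn : 2 ≤ n) (π : ℝ) (hπ0 : 0 < π) (hπ1 : π < 1)
    (B : ℕ → ℝ) (hBnonneg : ∀ k ≤ n, 0 ≤ B k)
    (hBsum : ∑ k ∈ range (n + 1), B k = 1)
    (hBmean : ∑ k ∈ range (n + 1), (k : ℝ) * B k = n * π)
    (Qa Qb : ℝ) (hQa : Qa ∈ Set.Icc (0 : ℝ) 1) (hQb : Qb ∈ Set.Icc (0 : ℝ) 1) :
    (∃ q : ℕ → ℝ, (∀ k ≤ n, 0 ≤ q k ∧ q k ≤ 1) ∧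
      (1 / (n * π)) * ∑ k ∈ range (n + 1), (k : ℝ) * q k * B k = Qa ∧
      (1 / (n * (1 - π))) * ∑ k ∈ range (n + 1), ((n : ℝ) - k) * q k * B k = Qb)
    ↔
    (∀ j ≤ n,
      (j : ℝ) * (1 - π) * Qb - ((n : ℝ) - j) * π * Qa
        + ∑ k ∈ Icc j n, ((k : ℝ) - j) * B k ≥ 0 ∧
      ((n : ℝ) - j) * π * Qa - (j : ℝ) * (1 - π) * Qb
        + ∑ k ∈ range (j + 1), ((j : ℝ) - k) * B k ≥ 0) := by
  have hn0 : (0 : ℝ) < n := by exact_mod_cast (by omega : 0 < n)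
  have hp1 : 0 < 1 - π := by linarith
  have lin : ∀ (q : ℕ → ℝ) (c : ℝ), ∑ k ∈ range (n + 1), ((k : ℝ) - c) * q k * B k
      = ∑ k ∈ range (n + 1), (k : ℝ) * q k * B k - c * ∑ k ∈ range (n + 1), q k * B k := by
    intro q c
    rw [mul_sum, ← sum_sub_distrib]
    exact sum_congr rfl fun k _ => by ring
  have lin2 : ∀ (q : ℕ → ℝ), ∑ k ∈ range (n + 1), ((n : ℝ) - k) * q k * B k
      = n * ∑ k ∈ range (n + 1), q k * B k - ∑ k ∈ range (n + 1), (k : ℝ) * q k * B k := by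
    intro q
    rw [mul_sum, ← sum_sub_distrib]
    exact sum_congr rfl fun k _ => by ring
  have comp : ∀ (q : ℕ → ℝ), ∑ k ∈ range (n + 1), (1 - q k) * B k
        = 1 - ∑ k ∈ range (n + 1), q k * B k ∧
      ∑ k ∈ range (n + 1), (k : ℝ) * (1 - q k) * B k
        = n * π - ∑ k ∈ range (n + 1), (k : ℝ) * q k * B k := by
    intro q
    rw [← hBmean, ← sum_sub_distrib]
    nth_rw 2 [← hBsum]
    rw [← sum_sub_distrib]
    exact ⟨sum_congr rfl fun k _ => by ring, sum_congr rfl fun k _ => by ring⟩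
  constructor
  · rintro ⟨q, hq, ha, hb⟩ j hj
    rw [lin2] at hb
    have b1 := rf_bound n B hBnonneg q hq j hj
    have b2 := rf_bound n B hBnonneg (fun k => 1 - q k)
      (fun k hk => ⟨by linarith [(hq k hk).2], by linarith [(hq k hk).1]⟩) j hj
    rw [lin] at b1 b2
    simp only [(comp q).1, (comp q).2] at b2
    rw [rf_high_eq n π B hBsum hBmean j hj]
    generalize ∑ k ∈ range (n + 1), q k * B k = s at *
    generalize ∑ k ∈ range (n + 1), (k : ℝ) * q k * B k = x at *
    generalize ∑ k ∈ range (j + 1), ((j : ℝ) - k) * B k = L at *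
    have e : ((n : ℝ) - j) * π * Qa - (j : ℝ) * (1 - π) * Qb = x - j * s := by
      rw [← ha, ← hb]; field_simp; ring
    constructor <;> linarith
  · intro H
    obtain ⟨ha0, ha1⟩ := hQa
    obtain ⟨hb0, hb1⟩ := hQb
    obtain ⟨s, hs⟩ : ∃ s, s = π * Qa + (1 - π) * Qb := ⟨_, rfl⟩
    obtain ⟨x, hx⟩ : ∃ x, x = n * π * Qa := ⟨_, rfl⟩
    have hs0 : 0 ≤ s := by rw [hs]; positivity
    have hs1 : s ≤ 1 := by rw [hs]; nlinarith
    obtain ⟨q, hq, m, hm, hqs, hqx⟩ := rf_lower n B hBnonneg hBsum s hs0 hs1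
    obtain ⟨r, hr, l, hl, hrs, hrx⟩ :=
      rf_lower n B hBnonneg hBsum (1 - s) (by linarith) (by linarith)
    have e : ∀ j : ℕ, ((n : ℝ) - j) * π * Qa - (j : ℝ) * (1 - π) * Qb = x - j * s := by
      intro j; rw [hs, hx]; ring
    have h1 : ∑ k ∈ range (n + 1), (k : ℝ) * q k * B k ≤ x := by
      have := (H m hm).2
      rw [e] at this
      linarith
    have h2 : x ≤ ∑ k ∈ range (n + 1), (k : ℝ) * (1 - r k) * B k := by
      have h := (H l hl).1
      rw [rf_high_eq n π B hBsum hBmean l hl] at h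
      have := e l
      rw [(comp r).2, hrx]
      linarith
    have h3 : ∑ k ∈ range (n + 1), (1 - r k) * B k = s := by
      rw [(comp r).1, hrs]; ring
    have hseg := (segment_eq_Icc (𝕜 := ℝ) (h1.trans h2)).symm ▸ (Set.mem_Icc.mpr ⟨h1, h2⟩)
    obtain ⟨a, b, ha, hb, hab, hxab⟩ := hseg
    simp only [smul_eq_mul] at hxab
    have f1 : ∑ k ∈ range (n + 1), (a * q k + b * (1 - r k)) * B k = s := by
      have : ∑ k ∈ range (n + 1), (a * q k + b * (1 - r k)) * B k = a * s + b * s := by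
        nth_rw 1 [← hqs]
        rw [← h3, mul_sum, mul_sum, ← sum_add_distrib]
        exact sum_congr rfl fun k _ => by ring
      rw [this, ← add_mul, hab, one_mul]
    have f2 : ∑ k ∈ range (n + 1), (k : ℝ) * (a * q k + b * (1 - r k)) * B k = x := by
      rw [← hxab, mul_sum, mul_sum, ← sum_add_distrib]
      exact sum_congr rfl fun k _ => by ring
    refine ⟨fun k => a * q k + b * (1 - r k), ?_, ?_, ?_⟩
    · intro k _
      obtain ⟨q0, q1⟩ := hq k
      obtain ⟨r0, r1⟩ := hr k
      constructor
      · have := mul_nonneg ha q0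
        have := mul_nonneg hb (sub_nonneg.mpr r1)
        linarith
      · have := mul_nonneg ha (sub_nonneg.mpr q1)
        have := mul_nonneg hb r0
        linarith
    · rw [f2, hx]; field_simp
    · rw [lin2, f1, f2, hx, hs]; field_simp; ring
end

section
/- A pair (Qa, Qb) ∈ [0,1]² is reduced form implementable by a monotone voting rule if and only if Qa ≥ Qb and for every j ∈ {0,1,...,n}: j·(1−π)·Qb − (n−j)·π·Qa + ∑_{k=j}^n (k−j)·B(k) ≥ 0. -/
open Finset

lemma tail_sum_eq (n j : ℕ) (B : ℕ → ℝ) :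
    ∑ k ∈ Icc j n, ((k : ℝ) - j) * B k
      = ∑ k ∈ range (n + 1), max ((k : ℝ) - j) 0 * B k := by
  have hsub : Icc j n ⊆ range (n + 1) := by
    intro k hk
    simp only [Finset.mem_Icc, Finset.mem_range] at *
    omega
  rw [← Finset.sum_subset hsub]
  · refine Finset.sum_congr rfl fun k hk => ?_
    have : (j : ℝ) ≤ k := by exact_mod_cast (Finset.mem_Icc.1 hk).1
    rw [max_eq_left (by linarith)]
  · intro k hk hk'
    have h : k ≤ j := by
      simp only [Finset.mem_Icc, Finset.mem_range] at *
      omega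
    have : (k : ℝ) ≤ j := by exact_mod_cast h
    rw [max_eq_right (by linarith), zero_mul]

lemma exists_threshold (n : ℕ) (B : ℕ → ℝ) (hBsum : ∑ k ∈ range (n + 1), B k = 1)
    (s : ℝ) (hs0 : 0 ≤ s) (hs1 : s ≤ 1) :
    ∃ q : ℕ → ℝ, ∃ m ≤ n, (∀ k, 0 ≤ q k ∧ q k ≤ 1) ∧ Monotone q ∧
      (∑ k ∈ range (n + 1), q k * B k = s) ∧
      (∀ k : ℕ, ((k : ℝ) - m) * q k = max ((k : ℝ) - m) 0) := by
  let F : ℝ → ℝ := fun x => ∑ k ∈ range (n + 1), max 0 (min 1 ((k : ℝ) - x)) * B k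
  have hF : ContinuousOn F (Set.Icc (-1) (n : ℝ)) := by
    apply Continuous.continuousOn
    fun_prop
  have h1 : F (-1) = 1 := by
    rw [← hBsum]
    refine Finset.sum_congr rfl fun k _ => ?_
    have : (0 : ℝ) ≤ k := k.cast_nonneg
    rw [min_eq_left (by linarith), max_eq_right (by norm_num), one_mul]
  have h0 : F n = 0 := by
    refine Finset.sum_eq_zero fun k hk => ?_
    have hk' : k ≤ n := by have := Finset.mem_range.1 hk; omega
    have : (k : ℝ) ≤ n := by exact_mod_cast hk'
    rw [min_eq_right (by linarith), max_eq_left (by linarith), zero_mul]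
  have hn0 : (0 : ℝ) ≤ n := n.cast_nonneg
  obtain ⟨x, hx, hxs⟩ := intermediate_value_Icc' (by linarith) hF
    (show s ∈ Set.Icc (F n) (F (-1)) by rw [h1, h0]; exact ⟨hs0, hs1⟩)
  refine ⟨fun k => max 0 (min 1 ((k : ℝ) - x)), ⌈x⌉₊, Nat.ceil_le.2 hx.2, ?_, ?_, hxs, ?_⟩
  · intro k
    exact ⟨le_max_left _ _, max_le zero_le_one (min_le_left _ _)⟩
  · intro a b hab
    have : (a : ℝ) ≤ b := by exact_mod_cast hab
    exact max_le_max le_rfl (min_le_min le_rfl (by linarith))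
  · intro k
    rcases lt_trichotomy k ⌈x⌉₊ with h | h | h
    · have h2 := Nat.lt_ceil.1 h
      have h3 : (k : ℝ) < ⌈x⌉₊ := by exact_mod_cast h
      simp only
      rw [min_eq_right (by linarith), max_eq_left (by linarith), max_eq_right (by linarith),
        mul_zero]
    · rw [← h]; simp
    · have h2 : (⌈x⌉₊ : ℝ) + 1 ≤ k := by exact_mod_cast h
      have h3 := Nat.le_ceil x
      simp only
      rw [min_eq_left (by linarith), max_eq_right (by linarith), max_eq_left (by linarith),
        mul_one]

/-- Equivalence of (1) and (4) in Theorem 3: `(Qa, Qb) ∈ [0,1]²` is reduced form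
implementable by a monotone voting rule iff `Qa ≥ Qb` and the family of `n+1` linear
inequalities holds. -/
theorem monotone_reduced_form_iff_inequalities
    (n : ℕ) (hn : 2 ≤ n) (π : ℝ) (hπ0 : 0 < π) (hπ1 : π < 1)
    (B : ℕ → ℝ) (hBnonneg : ∀ k ≤ n, 0 ≤ B k)
    (hBsum : ∑ k ∈ range (n + 1), B k = 1)
    (hBmean : ∑ k ∈ range (n + 1), (k : ℝ) * B k = n * π)
    (Qa Qb : ℝ) (hQa : Qa ∈ Set.Icc (0 : ℝ) 1) (hQb : Qb ∈ Set.Icc (0 : ℝ) 1) :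
    (∃ q : ℕ → ℝ, (∀ k ≤ n, 0 ≤ q k ∧ q k ≤ 1) ∧
      (∀ k, 1 ≤ k → k ≤ n → q (k - 1) ≤ q k) ∧
      (1 / (n * π)) * ∑ k ∈ range (n + 1), (k : ℝ) * q k * B k = Qa ∧
      (1 / (n * (1 - π))) * ∑ k ∈ range (n + 1), ((n : ℝ) - k) * q k * B k = Qb)
    ↔
    (Qa ≥ Qb ∧
      ∀ j ≤ n,
        (j : ℝ) * (1 - π) * Qb - ((n : ℝ) - j) * π * Qa
          + ∑ k ∈ Icc j n, ((k : ℝ) - j) * B k ≥ 0) := by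
  have hn0 : (0 : ℝ) < n := by exact_mod_cast (by omega : 0 < n)
  have hp : 0 < 1 - π := by linarith
  have hA : (n : ℝ) * π ≠ 0 := by positivity
  have hB' : (n : ℝ) * (1 - π) ≠ 0 := by positivity
  have hsplit : ∀ q : ℕ → ℝ, ∑ k ∈ range (n + 1), ((n : ℝ) - k) * q k * B k
      = n * ∑ k ∈ range (n + 1), q k * B k - ∑ k ∈ range (n + 1), (k : ℝ) * q k * B k := by
    intro q
    rw [Finset.mul_sum, ← Finset.sum_sub_distrib]
    exact Finset.sum_congr rfl fun k _ => by ring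
  have hshift : ∀ (q : ℕ → ℝ) (c : ℝ), ∑ k ∈ range (n + 1), ((k : ℝ) - c) * q k * B k
      = ∑ k ∈ range (n + 1), (k : ℝ) * q k * B k - c * ∑ k ∈ range (n + 1), q k * B k := by
    intro q c
    rw [Finset.mul_sum, ← Finset.sum_sub_distrib]
    exact Finset.sum_congr rfl fun k _ => by ring
  have hnn : ∀ k ∈ range (n + 1), k ≤ n := fun k hk => by
    have := Finset.mem_range.1 hk; omega
  constructor
  · rintro ⟨q, hq01, hqm, hqa, hqb⟩
    have ha : ∑ k ∈ range (n + 1), (k : ℝ) * q k * B k = n * π * Qa := by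
      rw [← hqa]; field_simp
    have hb : ∑ k ∈ range (n + 1), ((n : ℝ) - k) * q k * B k = n * (1 - π) * Qb := by
      rw [← hqb]; field_simp
    rw [hsplit, ha] at hb
    have hs : ∑ k ∈ range (n + 1), q k * B k = π * Qa + (1 - π) * Qb := by
      apply mul_left_cancel₀ hn0.ne'
      linarith
    have hmono : ∀ i j, i ≤ j → j ≤ n → q i ≤ q j := by
      intro i j hij
      induction j, hij using Nat.le_induction with
      | base => intro _; exact le_rfl
      | succ j hj ih =>
        intro hjn
        have := hqm (j + 1) (by omega) hjn
        simp only [Nat.add_sub_cancel] at this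
        exact (ih (by omega)).trans this
    constructor
    · have hmn : ⌊(n : ℝ) * π⌋₊ ≤ n := by
        apply Nat.floor_le_of_le
        nlinarith
      set m := ⌊(n : ℝ) * π⌋₊ with hm
      have h1 : ∑ k ∈ range (n + 1), ((k : ℝ) - n * π) * q m * B k
          ≤ ∑ k ∈ range (n + 1), ((k : ℝ) - n * π) * q k * B k := by
        refine Finset.sum_le_sum fun k hk => ?_
        refine mul_le_mul_of_nonneg_right ?_ (hBnonneg k (hnn k hk))
        rcases le_or_gt k m with h | h
        · have h2 : (k : ℝ) ≤ n * π := (Nat.le_floor_iff (by positivity)).1 h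
          exact mul_le_mul_of_nonpos_left (hmono k m h hmn) (by linarith)
        · have h2 : (n : ℝ) * π < k := (Nat.floor_lt (by positivity)).1 h
          exact mul_le_mul_of_nonneg_left (hmono m k h.le (hnn k hk)) (by linarith)
      have h2 : ∑ k ∈ range (n + 1), ((k : ℝ) - n * π) * q m * B k = 0 := by
        have e : ∀ k ∈ range (n + 1), ((k : ℝ) - n * π) * q m * B k
            = q m * ((k : ℝ) * B k) - q m * (n * π) * B k := fun k _ => by ring
        rw [Finset.sum_congr rfl e, Finset.sum_sub_distrib, ← Finset.mul_sum, ← Finset.mul_sum,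
          hBmean, hBsum]
        ring
      rw [h2, hshift, ha, hs] at h1
      have h3 : 0 ≤ (n * π * (1 - π)) * (Qa - Qb) := by linarith
      have h4 := nonneg_of_mul_nonneg_right h3 (by positivity)
      linarith
    · intro j hj
      rw [tail_sum_eq]
      have h1 : ∑ k ∈ range (n + 1), ((k : ℝ) - j) * q k * B k
          ≤ ∑ k ∈ range (n + 1), max ((k : ℝ) - j) 0 * B k := by
        refine Finset.sum_le_sum fun k hk => ?_
        refine mul_le_mul_of_nonneg_right ?_ (hBnonneg k (hnn k hk))
        obtain ⟨h0, h1⟩ := hq01 k (hnn k hk)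
        have h2 := le_max_left ((k : ℝ) - j) 0
        have h3 := le_max_right ((k : ℝ) - j) 0
        nlinarith
      rw [hshift, ha, hs] at h1
      linarith
  · rintro ⟨hab, hineq⟩
    obtain ⟨hQa0, hQa1⟩ := hQa
    obtain ⟨hQb0, hQb1⟩ := hQb
    have hs0 : 0 ≤ π * Qa + (1 - π) * Qb := by positivity
    have hs1 : π * Qa + (1 - π) * Qb ≤ 1 := by nlinarith
    obtain ⟨q, m, hm, hq01, hqm, hqs, hqk⟩ := exists_threshold n B hBsum _ hs0 hs1
    set s := π * Qa + (1 - π) * Qb with hs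
    have h1 := hineq m hm
    rw [tail_sum_eq] at h1
    have h2 : ∑ k ∈ range (n + 1), max ((k : ℝ) - m) 0 * B k
        = ∑ k ∈ range (n + 1), (k : ℝ) * q k * B k - m * s := by
      rw [← hqs, ← hshift]
      exact Finset.sum_congr rfl fun k _ => by rw [hqk]
    rw [h2] at h1
    set a1 := ∑ k ∈ range (n + 1), (k : ℝ) * q k * B k with ha1
    have hup : n * π * Qa ≤ a1 := by rw [hs] at h1; linarith
    have hlow : n * π * s ≤ n * π * Qa := by
      apply mul_le_mul_of_nonneg_left _ (by positivity)
      nlinarith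
    obtain ⟨t, ht0, ht1, ht⟩ : ∃ t : ℝ, 0 ≤ t ∧ t ≤ 1 ∧
        (1 - t) * (n * π * s) + t * a1 = n * π * Qa := by
      rcases eq_or_lt_of_le (hlow.trans hup) with h | h
      · exact ⟨0, le_rfl, zero_le_one, by linarith⟩
      · have hd : 0 < a1 - n * π * s := by linarith
        refine ⟨(n * π * Qa - n * π * s) / (a1 - n * π * s), ?_, ?_, ?_⟩
        · exact div_nonneg (by linarith) hd.le
        · rw [div_le_one hd]; linarith
        · have := div_mul_cancel₀ (n * π * Qa - n * π * s) hd.ne'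
          linarith
    have ea : ∑ k ∈ range (n + 1), (k : ℝ) * ((1 - t) * s + t * q k) * B k = n * π * Qa := by
      rw [← ht, ha1, ← hBmean, Finset.sum_mul, Finset.mul_sum, Finset.mul_sum,
        ← Finset.sum_add_distrib]
      exact Finset.sum_congr rfl fun k _ => by ring
    have es : ∑ k ∈ range (n + 1), ((1 - t) * s + t * q k) * B k = s := by
      have e : ∀ k ∈ range (n + 1), ((1 - t) * s + t * q k) * B k
          = ((1 - t) * s) * B k + t * (q k * B k) := fun k _ => by ring
      rw [Finset.sum_congr rfl e, Finset.sum_add_distrib, ← Finset.mul_sum, ← Finset.mul_sum,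
        hBsum, hqs]
      ring
    have ht' : 0 ≤ 1 - t := by linarith
    refine ⟨fun k => (1 - t) * s + t * q k, ?_, ?_, ?_, ?_⟩
    · intro k _
      obtain ⟨h3, h4⟩ := hq01 k
      constructor
      · positivity
      · nlinarith
    · intro k _ _
      have := mul_le_mul_of_nonneg_left (hqm (Nat.sub_le k 1)) ht0
      simp only
      linarith
    · simp only
      rw [ea]; field_simp
    · rw [hsplit (fun k => (1 - t) * s + t * q k)]
      rw [ea, es, hs]; field_simp; ring
end
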